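/- arXiv:1501.06260 — 2 statements merged into one kernel-verified Lean document; each statement's English description precedes it below -/
import Mathlib

section
/- (Theorem 1, attainment of the upper bound.) Let j_(n−1) ∈ ℝ^{n−1} be a nonzero eigenvector of W̃ for its largest eigenvalue λ_(n−1). Then for every c₃ ∈ ℝ and every c₄ ≠ 0, the vector y = c₃𝟙 + c₄ H j_(n−1) satisfies ỹ ≠ 0 and I(y) = λ_(n−1). -/
open Matrix BigOperators

/-- The centered vector `ỹ = y - ȳ 𝟙`, where `ȳ` is the mean of the entries of `y`. -/
noncomputable def ytilde (n : ℕ) (y : Fin n → ℝ) : Fin n → ℝ :=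
  y - fun _ => (∑ i, y i) / (n : ℝ)

/-- Moran's `I` statistic:
`I(y) = n (ỹᵀ W ỹ) / (S (ỹᵀ ỹ))` where `S = ∑_{i,j} w_{ij}`. -/
noncomputable def moranI (n : ℕ) (W : Matrix (Fin n) (Fin n) ℝ) (y : Fin n → ℝ) : ℝ :=
  (n : ℝ) * (ytilde n y ⬝ᵥ (W *ᵥ ytilde n y)) /
    ((∑ i, ∑ j, W i j) * (ytilde n y ⬝ᵥ ytilde n y))

/-- Centering removes the constant part of a vector whose remaining part sums to zero. -/
lemma ytilde_const_add {n : ℕ} (hn : n ≠ 0) (c : ℝ) {v : Fin n → ℝ} (hv : ∑ i, v i = 0) :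
    ytilde n (c • (fun _ => (1 : ℝ)) + v) = v := by
  have hn' : (n : ℝ) ≠ 0 := Nat.cast_ne_zero.mpr hn
  ext i
  simp [ytilde, Finset.sum_add_distrib, hv, hn']

/-- If every column of `H` sums to zero, so does every vector in its column space. -/
lemma sum_mulVec_eq_zero {m k : ℕ} {H : Matrix (Fin m) (Fin k) ℝ}
    (hH : Hᵀ *ᵥ (fun _ => (1 : ℝ)) = 0) (x : Fin k → ℝ) : ∑ i, (H *ᵥ x) i = 0 := by
  calc ∑ i, (H *ᵥ x) i = (H *ᵥ x) ⬝ᵥ (fun _ => (1 : ℝ)) := by simp [dotProduct]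
    _ = x ⬝ᵥ (Hᵀ *ᵥ (fun _ => (1 : ℝ))) := by
      rw [← vecMul_transpose, dotProduct_mulVec]
    _ = 0 := by rw [hH, dotProduct_zero]

/-- The quadratic form of `W` on the column space of `H` is that of `Hᵀ * W * H`. -/
lemma mulVec_dotProduct_mulVec_mulVec {m k : ℕ} (H : Matrix (Fin m) (Fin k) ℝ)
    (W : Matrix (Fin m) (Fin m) ℝ) (x : Fin k → ℝ) :
    (H *ᵥ x) ⬝ᵥ (W *ᵥ (H *ᵥ x)) = x ⬝ᵥ ((Hᵀ * W * H) *ᵥ x) := by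
  rw [← mulVec_mulVec, ← mulVec_mulVec, dotProduct_mulVec x, vecMul_transpose]

/-- Theorem 1, attainment of the upper bound: if `jmax ≠ 0` is an
eigenvector of `W̃` for its largest eigenvalue `λ₍ₙ₋₁₎`, then for every `c₃` and
every `c₄ ≠ 0`, the vector `y = c₃ 𝟙 + c₄ H jmax` satisfies `ỹ ≠ 0` and
`I(y) = λ₍ₙ₋₁₎`. -/
theorem moran_stmt_5 (n : ℕ) (hn : 2 ≤ n)
    (W : Matrix (Fin n) (Fin n) ℝ)
    (hWsym : W.IsSymm)
    (hWdiag : ∀ i, W i i = 0)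
    (hWnonneg : ∀ i j, i ≠ j → 0 ≤ W i j)
    (hS : 0 < ∑ i, ∑ j, W i j)
    (H : Matrix (Fin n) (Fin (n - 1)) ℝ)
    (hHcol : Hᵀ * H = 1)
    (hHone : Hᵀ *ᵥ (fun _ => (1 : ℝ)) = 0)
    (Wt : Matrix (Fin (n - 1)) (Fin (n - 1)) ℝ)
    (hWt : Wt = ((∑ i, ∑ j, W i j) / (n : ℝ))⁻¹ • (Hᵀ * W * H))
    (lamMax : ℝ)
    (hlamMax : IsGreatest (spectrum ℝ Wt) lamMax)
    (jmax : Fin (n - 1) → ℝ) (hjmax : jmax ≠ 0) (hjmaxeig : Wt *ᵥ jmax = lamMax • jmax)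
    (c₃ c₄ : ℝ) (hc₄ : c₄ ≠ 0) :
    ytilde n (c₃ • (fun _ => (1 : ℝ)) + c₄ • (H *ᵥ jmax)) ≠ 0 ∧
    moranI n W (c₃ • (fun _ => (1 : ℝ)) + c₄ • (H *ᵥ jmax)) = lamMax := by
  have hn0 : n ≠ 0 := by omega
  have hnR : (n : ℝ) ≠ 0 := Nat.cast_ne_zero.mpr hn0
  have hjj : jmax ⬝ᵥ jmax ≠ 0 := fun h => hjmax (dotProduct_self_eq_zero.mp h)
  have hy : ytilde n (c₃ • (fun _ => (1 : ℝ)) + c₄ • (H *ᵥ jmax)) = c₄ • (H *ᵥ jmax) := by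
    refine ytilde_const_add hn0 c₃ ?_
    rw [← mulVec_smul]
    exact sum_mulVec_eq_zero hHone _
  have hnorm : (H *ᵥ jmax) ⬝ᵥ (H *ᵥ jmax) = jmax ⬝ᵥ jmax := by
    simpa [hHcol] using mulVec_dotProduct_mulVec_mulVec H 1 jmax
  simp only [moranI, hy]
  generalize ∑ i, ∑ j, W i j = S at *
  have hquad : (H *ᵥ jmax) ⬝ᵥ (W *ᵥ (H *ᵥ jmax)) = S / n * (lamMax * (jmax ⬝ᵥ jmax)) := by
    have hSn : S / (n : ℝ) ≠ 0 := div_ne_zero hS.ne' hnR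
    have hWH : Hᵀ * W * H = (S / (n : ℝ)) • Wt := by rw [hWt, smul_inv_smul₀ hSn]
    rw [mulVec_dotProduct_mulVec_mulVec, hWH, smul_mulVec, hjmaxeig]
    simp only [dotProduct_smul, smul_eq_mul]
  constructor
  · refine smul_ne_zero hc₄ fun h => hjj ?_
    rw [← hnorm, h, dotProduct_zero]
  · simp only [mulVec_smul, dotProduct_smul, smul_dotProduct, smul_eq_mul, hnorm, hquad]
    have hS0 := hS.ne'
    field_simp
end

section
/- (Theorem 2, range of the alternative measure.) Assume (n−1)λ_(1) + 1 < 0 and (n−1)λ_(n−1) + 1 > 0. Then for every y ∈ ℝⁿ with ỹ := y − ȳ𝟙 ≠ 0, the alternative measure satisfies −1 ≤ I_M(y) ≤ 1. -/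
open Matrix BigOperators

/-- The alternative measure `I_M(y) = ((n-1) I(y) + 1) / C(y)`, where
`C(y) = |(n-1)λ₍₁₎ + 1|` if `(n-1) I(y) + 1 < 0` and
`C(y) = (n-1)λ₍ₙ₋₁₎ + 1` otherwise. -/
noncomputable def moranIM (n : ℕ) (W : Matrix (Fin n) (Fin n) ℝ) (lam1 lamMax : ℝ)
    (y : Fin n → ℝ) : ℝ :=
  if ((n : ℝ) - 1) * moranI n W y + 1 < 0 then
    (((n : ℝ) - 1) * moranI n W y + 1) / |((n : ℝ) - 1) * lam1 + 1|
  else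
    (((n : ℝ) - 1) * moranI n W y + 1) / (((n : ℝ) - 1) * lamMax + 1)

/-- The Rayleigh lower bound: a lower bound of the spectrum of a real symmetric matrix bounds its
quadratic form from below. -/
theorem mul_dotProduct_self_le_of_spectrum {m : Type*} [Fintype m] [DecidableEq m]
    {M : Matrix m m ℝ} (hM : M.IsSymm) {c : ℝ} (hc : ∀ x ∈ spectrum ℝ M, c ≤ x) (v : m → ℝ) :
    c * (v ⬝ᵥ v) ≤ v ⬝ᵥ (M *ᵥ v) := by
  have hpsd : (M - algebraMap ℝ (Matrix m m ℝ) c).PosSemidef := by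
    rw [Matrix.posSemidef_iff_isHermitian_and_spectrum_nonneg]
    refine ⟨?_, fun x hx => ?_⟩
    · rw [Matrix.IsHermitian, Matrix.conjTranspose_eq_transpose_of_trivial,
        Matrix.transpose_sub, hM.eq, Matrix.algebraMap_eq_diagonal, Matrix.diagonal_transpose]
    · rw [← spectrum.sub_singleton_eq] at hx
      obtain ⟨z, hz, w, rfl, rfl⟩ := Set.mem_sub.mp hx
      exact sub_nonneg.mpr (hc z hz)
  have h := hpsd.dotProduct_mulVec_nonneg v
  rw [star_trivial, Matrix.sub_mulVec, dotProduct_sub, Algebra.algebraMap_eq_smul_one,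
    Matrix.smul_mulVec, Matrix.one_mulVec, dotProduct_smul, smul_eq_mul] at h
  linarith

/-- The Rayleigh upper bound: an upper bound of the spectrum of a real symmetric matrix bounds its
quadratic form from above. -/
theorem le_mul_dotProduct_self_of_spectrum {m : Type*} [Fintype m] [DecidableEq m]
    {M : Matrix m m ℝ} (hM : M.IsSymm) {c : ℝ} (hc : ∀ x ∈ spectrum ℝ M, x ≤ c) (v : m → ℝ) :
    v ⬝ᵥ (M *ᵥ v) ≤ c * (v ⬝ᵥ v) := by
  have h := mul_dotProduct_self_le_of_spectrum (M := -M) (c := -c) hM.neg (fun x hx => by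
    rw [← spectrum.neg_eq, Set.mem_neg] at hx
    linarith [hc _ hx]) v
  rw [Matrix.neg_mulVec, dotProduct_neg] at h
  linarith

/-- If the `n - 1` columns of `H` are orthonormal and orthogonal to the all-ones vector, then
`H * Hᵀ` fixes every vector whose entries sum to zero. -/
theorem mulVec_transpose_mulVec_of_sum_eq_zero {n : ℕ} (hn : n ≠ 0)
    {H : Matrix (Fin n) (Fin (n - 1)) ℝ} (hHcol : Hᵀ * H = 1)
    (hHone : Hᵀ *ᵥ (fun _ => (1 : ℝ)) = 0) {u : Fin n → ℝ} (hu : ∑ i, u i = 0) :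
    H *ᵥ (Hᵀ *ᵥ u) = u := by
  let e : Matrix (Fin n) Unit ℝ := Matrix.of fun _ _ => 1
  let f : Matrix Unit (Fin n) ℝ := Matrix.of fun _ _ => (n : ℝ)⁻¹
  have hsum : ∀ j, ∑ i, H i j = 0 := fun j => by
    simpa [Matrix.mulVec, dotProduct] using congrFun hHone j
  have hHe : Hᵀ * e = 0 := by
    ext j k
    simpa [e, Matrix.mul_apply] using hsum j
  have hfH : f * H = 0 := by
    ext k j
    simp [f, Matrix.mul_apply, ← Finset.mul_sum, hsum j]
  have hfe : f * e = 1 := by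
    ext k l
    simp [e, f, Matrix.mul_apply, hn]
  have hleft : Matrix.fromRows Hᵀ f * Matrix.fromCols H e = 1 := by
    rw [Matrix.fromRows_mul_fromCols, hHcol, hHe, hfH, hfe, Matrix.fromBlocks_one]
  have hright : Matrix.fromCols H e * Matrix.fromRows Hᵀ f = 1 :=
    (Matrix.mul_eq_one_comm_of_card_eq _ _ _ (by simp; omega)).mp hleft
  rw [Matrix.fromCols_mul_fromRows] at hright
  have hef : (e * f) *ᵥ u = 0 := by
    ext i
    simp [e, f, Matrix.mulVec, dotProduct, Matrix.mul_apply, ← Finset.mul_sum, hu]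
  calc H *ᵥ (Hᵀ *ᵥ u) = (H * Hᵀ + e * f) *ᵥ u := by
        rw [Matrix.add_mulVec, hef, add_zero, Matrix.mulVec_mulVec]
    _ = u := by rw [hright, Matrix.one_mulVec]

theorem sum_ytilde {n : ℕ} (hn : n ≠ 0) (y : Fin n → ℝ) : ∑ i, ytilde n y i = 0 := by
  have : (n : ℝ) ≠ 0 := Nat.cast_ne_zero.mpr hn
  simp only [ytilde, Pi.sub_apply, Finset.sum_sub_distrib, Finset.sum_const, Finset.card_univ,
    Fintype.card_fin, nsmul_eq_mul]
  field_simp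
  ring

/-- Theorem 2, range of the alternative measure: if
`(n-1)λ₍₁₎ + 1 < 0` and `(n-1)λ₍ₙ₋₁₎ + 1 > 0`, then for every `y` with
`ỹ ≠ 0`, the alternative measure satisfies `-1 ≤ I_M(y) ≤ 1`. -/
theorem moran_stmt_16 (n : ℕ) (hn : 2 ≤ n)
    (W : Matrix (Fin n) (Fin n) ℝ)
    (hWsym : W.IsSymm)
    (hWdiag : ∀ i, W i i = 0)
    (hWnonneg : ∀ i j, i ≠ j → 0 ≤ W i j)
    (hS : 0 < ∑ i, ∑ j, W i j)
    (H : Matrix (Fin n) (Fin (n - 1)) ℝ)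
    (hHcol : Hᵀ * H = 1)
    (hHone : Hᵀ *ᵥ (fun _ => (1 : ℝ)) = 0)
    (Wt : Matrix (Fin (n - 1)) (Fin (n - 1)) ℝ)
    (hWt : Wt = ((∑ i, ∑ j, W i j) / (n : ℝ))⁻¹ • (Hᵀ * W * H))
    (lam1 lamMax : ℝ)
    (hlam1 : IsLeast (spectrum ℝ Wt) lam1)
    (hlamMax : IsGreatest (spectrum ℝ Wt) lamMax)
    (ha : ((n : ℝ) - 1) * lam1 + 1 < 0)
    (hb : 0 < ((n : ℝ) - 1) * lamMax + 1)
    (y : Fin n → ℝ) (hy : ytilde n y ≠ 0) :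
    -1 ≤ moranIM n W lam1 lamMax y ∧ moranIM n W lam1 lamMax y ≤ 1 := by
  have hn0 : n ≠ 0 := by omega
  have hnpos : (0 : ℝ) < n := by positivity
  have hn1 : (0 : ℝ) ≤ (n : ℝ) - 1 := by
    have : (2 : ℝ) ≤ n := by exact_mod_cast hn
    linarith
  have hWtsym : Wt.IsSymm := by
    rw [hWt]
    refine Matrix.IsSymm.smul ?_ _
    rw [Matrix.IsSymm, Matrix.transpose_mul, Matrix.transpose_mul, Matrix.transpose_transpose,
      hWsym.eq, Matrix.mul_assoc]
  set v := Hᵀ *ᵥ ytilde n y with hv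
  have hHv : H *ᵥ v = ytilde n y :=
    mulVec_transpose_mulVec_of_sum_eq_zero hn0 hHcol hHone (sum_ytilde hn0 y)
  have hnorm : v ⬝ᵥ v = ytilde n y ⬝ᵥ ytilde n y := by
    nth_rewrite 1 [hv]
    rw [Matrix.mulVec_transpose, ← Matrix.dotProduct_mulVec, hHv]
  have hquad : v ⬝ᵥ (Wt *ᵥ v) =
      ((∑ i, ∑ j, W i j) / (n : ℝ))⁻¹ * (ytilde n y ⬝ᵥ (W *ᵥ ytilde n y)) := by
    rw [hWt, Matrix.smul_mulVec, dotProduct_smul, smul_eq_mul, ← Matrix.mulVec_mulVec, hHv,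
      ← Matrix.mulVec_mulVec, Matrix.dotProduct_mulVec v, Matrix.vecMul_transpose, hHv]
  have hpos : 0 < v ⬝ᵥ v := by
    rw [hnorm]
    exact (dotProduct_self_star_pos_iff (v := ytilde n y)).mpr hy
  have hI : moranI n W y = v ⬝ᵥ (Wt *ᵥ v) / (v ⬝ᵥ v) := by
    rw [hquad, hnorm, moranI, inv_div]
    ring
  have hlow : lam1 ≤ moranI n W y := by
    rw [hI, le_div_iff₀ hpos]
    exact mul_dotProduct_self_le_of_spectrum hWtsym (fun x hx => hlam1.2 hx) v
  have hupp : moranI n W y ≤ lamMax := by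
    rw [hI, div_le_iff₀ hpos]
    exact le_mul_dotProduct_self_of_spectrum hWtsym (fun x hx => hlamMax.2 hx) v
  have hlow' := mul_le_mul_of_nonneg_left hlow hn1
  have hupp' := mul_le_mul_of_nonneg_left hupp hn1
  rw [moranIM]
  split_ifs with hneg
  · rw [abs_of_neg ha, le_div_iff₀ (neg_pos.mpr ha), div_le_iff₀ (neg_pos.mpr ha)]
    constructor <;> linarith
  · rw [le_div_iff₀ hb, div_le_iff₀ hb]
    constructor <;> linarith
end
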